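/- arXiv:1908.07908 — 2 statements merged into one kernel-verified Lean document; each statement's English description precedes it below -/
import Mathlib

section
/- Let M be an n×p real matrix, R a positive definite n×n real matrix, Ω a positive definite p×p real matrix, y : Fin n → ℝ and α : Fin p → ℝ. Set C := (Mᵀ R⁻¹ M + Ω⁻¹)⁻¹ and θ̂ := C · (Mᵀ R⁻¹ y + Ω⁻¹ α) (matrix–vector products). Then for every θ : Fin p → ℝ, (y − Mθ)ᵀ R⁻¹ (y − Mθ) + (θ − α)ᵀ Ω⁻¹ (θ − α) = (θ − θ̂)ᵀ C⁻¹ (θ − θ̂) + (y − Mα)ᵀ (R + M Ω Mᵀ)⁻¹ (y − Mα). -/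
open Matrix

/-- The bilinear form of a symmetric matrix is symmetric. -/
theorem Matrix.IsSymm.dotProduct_mulVec_comm {m α : Type*} [Fintype m] [CommSemiring α]
    {S : Matrix m m α} (hS : S.IsSymm) (a b : m → α) :
    a ⬝ᵥ (S *ᵥ b) = b ⬝ᵥ (S *ᵥ a) := by
  rw [dotProduct_mulVec, ← mulVec_transpose, hS.eq, dotProduct_comm]

/-- Expansion of the quadratic form of a symmetric matrix at a difference. -/
theorem Matrix.IsSymm.sub_dotProduct_mulVec_sub {m α : Type*} [Fintype m] [CommRing α]
    {S : Matrix m m α} (hS : S.IsSymm) (a d : m → α) :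
    (a - d) ⬝ᵥ (S *ᵥ (a - d)) =
      a ⬝ᵥ (S *ᵥ a) - 2 * a ⬝ᵥ (S *ᵥ d) + d ⬝ᵥ (S *ᵥ d) := by
  rw [mulVec_sub, dotProduct_sub, sub_dotProduct, sub_dotProduct,
    hS.dotProduct_mulVec_comm d a]
  ring

/-- Completion-of-squares identity behind the normal-hierarchy Lemma:
`(y − Mθ)ᵀ R⁻¹ (y − Mθ) + (θ − α)ᵀ Ω⁻¹ (θ − α)
  = (θ − θ̂)ᵀ C⁻¹ (θ − θ̂) + (y − Mα)ᵀ (R + M Ω Mᵀ)⁻¹ (y − Mα)`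
where `C = (Mᵀ R⁻¹ M + Ω⁻¹)⁻¹` and `θ̂ = C (Mᵀ R⁻¹ y + Ω⁻¹ α)`. -/
theorem stmt_1 {n p : ℕ} (M : Matrix (Fin n) (Fin p) ℝ)
    {R : Matrix (Fin n) (Fin n) ℝ} {Ω : Matrix (Fin p) (Fin p) ℝ}
    (hR : R.PosDef) (hΩ : Ω.PosDef) (y : Fin n → ℝ) (α : Fin p → ℝ)
    (C : Matrix (Fin p) (Fin p) ℝ) (hC : C = (Mᵀ * R⁻¹ * M + Ω⁻¹)⁻¹)
    (θhat : Fin p → ℝ) (hθhat : θhat = C *ᵥ ((Mᵀ * R⁻¹) *ᵥ y + Ω⁻¹ *ᵥ α)) :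
    ∀ θ : Fin p → ℝ,
      (y - M *ᵥ θ) ⬝ᵥ (R⁻¹ *ᵥ (y - M *ᵥ θ)) + (θ - α) ⬝ᵥ (Ω⁻¹ *ᵥ (θ - α)) =
        (θ - θhat) ⬝ᵥ (C⁻¹ *ᵥ (θ - θhat)) +
          (y - M *ᵥ α) ⬝ᵥ ((R + M * Ω * Mᵀ)⁻¹ *ᵥ (y - M *ᵥ α)) := by
  intro θ
  have hRs : R⁻¹.IsSymm := hR.inv.isHermitian
  have hPSD : (Mᵀ * R⁻¹ * M).PosSemidef := hR.inv.posSemidef.conjTranspose_mul_mul_same M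
  have hK : (Mᵀ * R⁻¹ * M + Ω⁻¹).PosDef := PosDef.posSemidef_add hPSD hΩ.inv
  have hKs : (Mᵀ * R⁻¹ * M + Ω⁻¹).IsSymm := hK.isHermitian
  have hKdet := (isUnit_iff_isUnit_det _).mp hK.isUnit
  have hW : (R + M * Ω * Mᵀ)⁻¹ =
      R⁻¹ - R⁻¹ * M * (Mᵀ * R⁻¹ * M + Ω⁻¹)⁻¹ * Mᵀ * R⁻¹ := by
    rw [add_mul_mul_inv_eq_sub _ _ _ _ hR.isUnit hΩ.isUnit
      (by rw [add_comm]; exact hK.isUnit), add_comm Ω⁻¹]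
  rw [hW, hθhat, hC, nonsing_inv_nonsing_inv _ hKdet]
  set K := Mᵀ * R⁻¹ * M + Ω⁻¹ with hKdef
  obtain ⟨z, rfl⟩ : ∃ z, y = z + M *ᵥ α := ⟨y - M *ᵥ α, by simp⟩
  obtain ⟨u, rfl⟩ : ∃ u, θ = u + α := ⟨θ - α, by simp⟩
  set w := (Mᵀ * R⁻¹) *ᵥ z with hw
  set d := K⁻¹ *ᵥ w with hd
  have hKd : K *ᵥ d = w := by
    rw [hd, mulVec_mulVec, mul_nonsing_inv _ hKdet, one_mulVec]
  have hmean : K⁻¹ *ᵥ ((Mᵀ * R⁻¹) *ᵥ (z + M *ᵥ α) + Ω⁻¹ *ᵥ α) = d + α := by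
    have h : (Mᵀ * R⁻¹) *ᵥ (z + M *ᵥ α) + Ω⁻¹ *ᵥ α = w + K *ᵥ α := by
      rw [mulVec_add, mulVec_mulVec, hKdef, add_mulVec, add_assoc]
    rw [h, mulVec_add, mulVec_mulVec α, nonsing_inv_mul _ hKdet, one_mulVec]
  have hadj : ∀ (a : Fin p → ℝ) (b : Fin n → ℝ), (M *ᵥ a) ⬝ᵥ b = a ⬝ᵥ (Mᵀ *ᵥ b) := by
    intro a b
    rw [dotProduct_comm, dotProduct_mulVec, ← mulVec_transpose, dotProduct_comm]
  have hquad : u ⬝ᵥ (K *ᵥ u) =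
      (M *ᵥ u) ⬝ᵥ (R⁻¹ *ᵥ (M *ᵥ u)) + u ⬝ᵥ (Ω⁻¹ *ᵥ u) := by
    rw [hadj, hKdef, add_mulVec, dotProduct_add]
    simp only [mulVec_mulVec, Matrix.mul_assoc]
  have hcross : z ⬝ᵥ (R⁻¹ *ᵥ (M *ᵥ u)) = u ⬝ᵥ w := by
    rw [hRs.dotProduct_mulVec_comm, hadj, mulVec_mulVec]
  have hres : z ⬝ᵥ ((R⁻¹ * M * K⁻¹ * Mᵀ * R⁻¹) *ᵥ z) = d ⬝ᵥ w := by
    have h : (R⁻¹ * M * K⁻¹ * Mᵀ * R⁻¹) *ᵥ z = R⁻¹ *ᵥ (M *ᵥ d) := by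
      simp only [hd, hw, mulVec_mulVec, Matrix.mul_assoc]
    rw [h, hRs.dotProduct_mulVec_comm, hadj, mulVec_mulVec]
  have hy : z + M *ᵥ α - M *ᵥ (u + α) = z - M *ᵥ u := by
    rw [mulVec_add, add_sub_add_right_eq_sub]
  rw [hmean, hy, add_sub_cancel_right, add_sub_cancel_right, add_sub_add_right_eq_sub,
    hRs.sub_dotProduct_mulVec_sub, hKs.sub_dotProduct_mulVec_sub, hKd, sub_mulVec,
    dotProduct_sub, hres, hquad, hcross]
  ring
end

section
/- Let C be a p×m real matrix with Cᵀ C invertible, set Π := I − C (Cᵀ C)⁻¹ Cᵀ, and let γ : (Fin p → ℝ) → (Fin p → ℝ) be any map (in the PING algorithm, the gradient of the objective g). Suppose v satisfies Π (γ v) ≠ 0 and v = Π (γ v) / ‖Π (γ v)‖ (Euclidean norm). Then ‖v‖ = 1, Cᵀ v = 0, and there exists μ : Fin m → ℝ such that γ v = ‖Π (γ v)‖ • v + C μ; i.e. every fixed point of the PING iteration is a stationary point of the constrained program max g(v) subject to vᵀv = 1 and Cᵀv = 0. -/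
open Matrix

/-- Every fixed point of the PING iteration
`v ↦ Π_{C⊥} γ(v) / ‖Π_{C⊥} γ(v)‖`, with `Π_{C⊥} = I − C (Cᵀ C)⁻¹ Cᵀ`, is a feasible
stationary point of the program `max g(v)` s.t. `vᵀv = 1`, `Cᵀv = 0`:
it is a unit vector satisfying the constraints, and `γ(v) = ‖Π_{C⊥} γ(v)‖ v + C μ`
for some Lagrange multipliers. -/
theorem stmt_11 {p m : ℕ} (C : Matrix (Fin p) (Fin m) ℝ) (hC : IsUnit (Cᵀ * C))
    (P : Matrix (Fin p) (Fin p) ℝ) (hP : P = 1 - C * (Cᵀ * C)⁻¹ * Cᵀ)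
    (γ : (Fin p → ℝ) → (Fin p → ℝ)) (v : Fin p → ℝ)
    (hne : P *ᵥ γ v ≠ 0)
    (hv : v = (Real.sqrt ((P *ᵥ γ v) ⬝ᵥ (P *ᵥ γ v)))⁻¹ • (P *ᵥ γ v)) :
    Real.sqrt (v ⬝ᵥ v) = 1 ∧ Cᵀ *ᵥ v = 0 ∧
      ∃ μ : Fin m → ℝ,
        γ v = Real.sqrt ((P *ᵥ γ v) ⬝ᵥ (P *ᵥ γ v)) • v + C *ᵥ μ := by
  generalize γ v = w at *
  have hCP : Cᵀ * P = 0 := by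
    rw [hP, Matrix.mul_sub, Matrix.mul_one, ← Matrix.mul_assoc, ← Matrix.mul_assoc,
      Matrix.mul_nonsing_inv _ ((Matrix.isUnit_iff_isUnit_det _).mp hC), Matrix.one_mul, sub_self]
  have hw : w = P *ᵥ w + C *ᵥ ((Cᵀ * C)⁻¹ *ᵥ (Cᵀ *ᵥ w)) := by
    rw [hP, Matrix.sub_mulVec, Matrix.one_mulVec, Matrix.mulVec_mulVec, Matrix.mulVec_mulVec,
      sub_add_cancel]
  have hCu : Cᵀ *ᵥ (P *ᵥ w) = 0 := by rw [Matrix.mulVec_mulVec, hCP, Matrix.zero_mulVec]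
  generalize P *ᵥ w = u at *
  have hnonneg : 0 ≤ u ⬝ᵥ u := Finset.sum_nonneg fun i _ => mul_self_nonneg (u i)
  have hpos : 0 < u ⬝ᵥ u :=
    lt_of_le_of_ne hnonneg fun h => hne (dotProduct_self_eq_zero.mp h.symm)
  have hs : Real.sqrt (u ⬝ᵥ u) ≠ 0 := (Real.sqrt_pos.mpr hpos).ne'
  have hsq : Real.sqrt (u ⬝ᵥ u) * Real.sqrt (u ⬝ᵥ u) = u ⬝ᵥ u := Real.mul_self_sqrt hnonneg
  refine ⟨?_, ?_, (Cᵀ * C)⁻¹ *ᵥ (Cᵀ *ᵥ w), ?_⟩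
  · rw [Real.sqrt_eq_one, hv, smul_dotProduct, dotProduct_smul, smul_eq_mul, smul_eq_mul,
      ← mul_assoc, ← mul_inv, hsq, inv_mul_cancel₀ hpos.ne']
  · rw [hv, Matrix.mulVec_smul, hCu, smul_zero]
  · rw [hv, smul_inv_smul₀ hs]
    exact hw
end
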